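/- For a > 1 and φ a smooth bump supported in {1/2 < |ξ| < 2}, the kernel K(x,t) = ∫_{ℝ^n} e^{i(x·ξ + t|ξ|^a)} φ(|ξ|)² dξ satisfies the uniform decay bound |K(x,t)| ≤ C (1 + |(x,t)|)^{-n/2} for all (x,t) ∈ ℝ^{n+1}. -/

import Mathlib

open MeasureTheory Set

noncomputable section

section UniformlySmooth

open scoped ContDiff

variable {E Θ : Type*} [NormedAddCommGroup E] [NormedSpace ℝ E]

/-- A family of smooth functions all of whose derivatives are bounded uniformly over the family. -/
def UniformlySmooth (u : Θ → E → ℝ) : Prop :=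
  (∀ θ, ContDiff ℝ ∞ (u θ)) ∧ ∀ k : ℕ, ∃ C, ∀ θ x, ‖iteratedFDeriv ℝ k (u θ) x‖ ≤ C

theorem UniformlySmooth.bounded {u : Θ → E → ℝ} (hu : UniformlySmooth u) :
    ∃ C, ∀ θ x, |u θ x| ≤ C := by
  obtain ⟨C, hC⟩ := hu.2 0
  exact ⟨C, fun θ x => by simpa using hC θ x⟩

theorem UniformlySmooth.reindex {Θ' : Type*} {u : Θ → E → ℝ} (hu : UniformlySmooth u)
    (g : Θ' → Θ) : UniformlySmooth fun θ => u (g θ) :=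
  ⟨fun _ => hu.1 _, fun k => (hu.2 k).imp fun _ hC _ x => hC _ x⟩

theorem UniformlySmooth.comp_add {u : Θ → E → ℝ} (hu : UniformlySmooth u) (h : Θ → E) :
    UniformlySmooth fun θ x => u θ (x + h θ) := by
  refine ⟨fun θ => (hu.1 θ).comp (by fun_prop), fun k => ?_⟩
  obtain ⟨C, hC⟩ := hu.2 k
  refine ⟨C, fun θ x => ?_⟩
  rw [iteratedFDeriv_comp_add_right]
  exact hC _ _

theorem UniformlySmooth.const : UniformlySmooth fun (_ : Θ) (_ : E) => (1 : ℝ) := by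
  refine ⟨fun θ => contDiff_const, fun k => ?_⟩
  by_cases hk : k = 0
  · subst hk
    exact ⟨1, fun θ x => by simp⟩
  · exact ⟨0, fun θ x => by simp [iteratedFDeriv_const_of_ne hk]⟩

theorem UniformlySmooth.add {u v : Θ → E → ℝ} (hu : UniformlySmooth u) (hv : UniformlySmooth v) :
    UniformlySmooth fun θ x => u θ x + v θ x := by
  refine ⟨fun θ => (hu.1 θ).add (hv.1 θ), fun k => ?_⟩
  obtain ⟨C, hC⟩ := hu.2 k
  obtain ⟨D, hD⟩ := hv.2 k
  refine ⟨C + D, fun θ x => ?_⟩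
  rw [fun_iteratedFDeriv_add_apply ((hu.1 θ).contDiffAt.of_le (by exact_mod_cast le_top))
    ((hv.1 θ).contDiffAt.of_le (by exact_mod_cast le_top))]
  exact (norm_add_le _ _).trans (add_le_add (hC θ x) (hD θ x))

theorem UniformlySmooth.const_mul {u : Θ → E → ℝ} (hu : UniformlySmooth u) {c : Θ → ℝ} {M : ℝ}
    (hc : ∀ θ, |c θ| ≤ M) : UniformlySmooth fun θ x => c θ * u θ x := by
  refine ⟨fun θ => contDiff_const.mul (hu.1 θ), fun k => ?_⟩
  obtain ⟨C, hC⟩ := hu.2 k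
  refine ⟨M * C, fun θ x => ?_⟩
  have := iteratedFDeriv_const_smul_apply' (a := c θ) (x := x)
    ((hu.1 θ).contDiffAt.of_le (m := (k : WithTop ℕ∞)) (by exact_mod_cast le_top))
  simp only [smul_eq_mul] at this
  rw [this, norm_smul]
  exact mul_le_mul (hc θ) (hC θ x) (norm_nonneg _) ((abs_nonneg _).trans (hc θ))

theorem UniformlySmooth.mul {u v : Θ → E → ℝ} (hu : UniformlySmooth u) (hv : UniformlySmooth v) :
    UniformlySmooth fun θ x => u θ x * v θ x := by
  refine ⟨fun θ => (hu.1 θ).mul (hv.1 θ), fun k => ?_⟩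
  choose C hC using hu.2
  choose D hD using hv.2
  refine ⟨∑ i ∈ Finset.range (k + 1), (k.choose i : ℝ) * C i * D (k - i), fun θ x => ?_⟩
  refine (norm_iteratedFDeriv_mul_le (N := k) ((hu.1 θ).of_le (by exact_mod_cast le_top))
    ((hv.1 θ).of_le (by exact_mod_cast le_top)) x le_rfl).trans ?_
  refine Finset.sum_le_sum fun i _ => ?_
  have hCi := (norm_nonneg _).trans (hC i θ x)
  gcongr
  · exact hC i θ x
  · exact hD _ θ x

theorem UniformlySmooth.comp {u : Θ → E → ℝ} (hu : UniformlySmooth u) {J : ℝ → ℝ}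
    (hJ : ContDiff ℝ ∞ J) : UniformlySmooth fun θ x => J (u θ x) := by
  refine ⟨fun θ => hJ.comp (hu.1 θ), fun k => ?_⟩
  obtain ⟨M, hM⟩ := hu.bounded
  choose D hD using hu.2
  have hbd : ∀ i : ℕ, ∃ C, ∀ y ∈ Icc (-M) M, ‖iteratedFDeriv ℝ i J y‖ ≤ C := fun i =>
    isCompact_Icc.exists_bound_of_continuousOn
      (hJ.continuous_iteratedFDeriv (by exact_mod_cast le_top)).continuousOn
  choose C hC using hbd
  refine ⟨k.factorial * (∑ i ∈ Finset.range (k + 1), |C i|) *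
    (1 + ∑ i ∈ Finset.range (k + 1), |D i|) ^ k, fun θ x => ?_⟩
  have hle : ∀ (F : ℕ → ℝ) {i : ℕ}, i ≤ k → F i ≤ ∑ i ∈ Finset.range (k + 1), |F i| :=
    fun F i hi => (le_abs_self _).trans
      (Finset.single_le_sum (f := fun i => |F i|) (fun _ _ => abs_nonneg _)
        (Finset.mem_range.2 (by lia)))
  have h1 : 1 ≤ 1 + ∑ i ∈ Finset.range (k + 1), |D i| :=
    le_add_of_nonneg_right (Finset.sum_nonneg fun _ _ => abs_nonneg _)
  refine norm_iteratedFDeriv_comp_le (N := k) (g := J) (f := u θ)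
    (hJ.of_le (by exact_mod_cast le_top))
    ((hu.1 θ).of_le (by exact_mod_cast le_top)) le_rfl x ?_ ?_
  · exact fun i hi => (hC i _ (abs_le.1 (hM θ x))).trans (hle C hi)
  · intro i hi hik
    calc ‖iteratedFDeriv ℝ i (u θ) x‖ ≤ D i := hD i θ x
      _ ≤ 1 + ∑ i ∈ Finset.range (k + 1), |D i| := by linarith [hle D hik]
      _ ≤ _ := le_self_pow₀ h1 (by lia)

theorem UniformlySmooth.fderiv_apply {u : Θ → E → ℝ} (hu : UniformlySmooth u) {w : Θ → E}
    (hw : ∀ θ, ‖w θ‖ ≤ 1) : UniformlySmooth fun θ x => fderiv ℝ (u θ) x (w θ) := by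
  have hd : ∀ θ, ContDiff ℝ ∞ (fderiv ℝ (u θ)) := fun θ =>
    (hu.1 θ).fderiv_right (by exact_mod_cast le_top)
  refine ⟨fun θ => (hd θ).clm_apply contDiff_const, fun k => ?_⟩
  obtain ⟨C, hC⟩ := hu.2 (k + 1)
  refine ⟨C, fun θ x => ?_⟩
  refine (norm_iteratedFDeriv_clm_apply_const (N := k)
    ((hd θ).contDiffAt.of_le (by exact_mod_cast le_top)) le_rfl).trans ?_
  rw [norm_iteratedFDeriv_fderiv]
  exact (mul_le_of_le_one_left (norm_nonneg _) (hw θ)).trans (hC θ x)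

theorem UniformlySmooth.difference_quotient {u : Θ → E → ℝ} (hu : UniformlySmooth u) (h : Θ → E) :
    UniformlySmooth fun θ x => ‖h θ‖⁻¹ * (u θ (x + h θ) - u θ x) := by
  have hs : ∀ θ, ContDiff ℝ ∞ fun x => u θ (x + h θ) := (hu.comp_add h).1
  refine ⟨fun θ => contDiff_const.mul ((hs θ).sub (hu.1 θ)), fun k => ?_⟩
  obtain ⟨C, hC⟩ := hu.2 (k + 1)
  refine ⟨C, fun θ x => ?_⟩
  have hk : (k : WithTop ℕ∞) ≤ ∞ := by exact_mod_cast le_top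
  have e1 := iteratedFDeriv_const_smul_apply' (a := ‖h θ‖⁻¹) (x := x)
    (((hs θ).sub (hu.1 θ)).contDiffAt.of_le hk)
  simp only [smul_eq_mul] at e1
  rw [e1, fun_iteratedFDeriv_sub_apply ((hs θ).contDiffAt.of_le hk)
    ((hu.1 θ).contDiffAt.of_le hk), iteratedFDeriv_comp_add_right, norm_smul, norm_inv, norm_norm]
  have hC0 : 0 ≤ C := (norm_nonneg _).trans (hC θ x)
  have hmv := Convex.norm_image_sub_le_of_norm_fderiv_le (𝕜 := ℝ)
    (f := iteratedFDeriv ℝ k (u θ)) (s := univ) (C := C) (x := x) (y := x + h θ)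
    (fun y _ => ((hu.1 θ).differentiable_iteratedFDeriv
      (by exact_mod_cast WithTop.coe_lt_top k)) y)
    (fun y _ => by rw [norm_fderiv_iteratedFDeriv]; exact hC θ y) convex_univ trivial trivial
  rw [add_sub_cancel_left] at hmv
  by_cases h0 : ‖h θ‖ = 0
  · simp [h0, hC0]
  · have : 0 < ‖h θ‖ := lt_of_le_of_ne (norm_nonneg _) (Ne.symm h0)
    calc _ ≤ ‖h θ‖⁻¹ * (C * ‖h θ‖) := by gcongr
      _ = C := by field_simp

theorem uniformlySmooth_of_hasCompactSupport {f : E → ℝ} (hf : ContDiff ℝ ∞ f)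
    (hc : HasCompactSupport f) : UniformlySmooth fun _ : Θ => f := by
  refine ⟨fun _ => hf, fun k => ?_⟩
  obtain ⟨C, hC⟩ := (hf.continuous_iteratedFDeriv
    (m := k) (by exact_mod_cast le_top)).bounded_above_of_compact_support (hc.iteratedFDeriv k)
  exact ⟨C, fun _ => hC⟩

/-- A globally smooth function that agrees with the inverse on `[c, ∞)`. -/
theorem exists_contDiff_mul_eq_one {c : ℝ} (hc : 0 < c) :
    ∃ J : ℝ → ℝ, ContDiff ℝ ∞ J ∧ ∀ q, c ≤ q → q * J q = 1 := by
  refine ⟨fun q => Real.smoothTransition (2 * q / c - 1) * q⁻¹, ?_, fun q hq => ?_⟩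
  · refine contDiff_iff_contDiffAt.2 fun q => ?_
    by_cases hq : q = 0
    · subst hq
      have : (fun q : ℝ => Real.smoothTransition (2 * q / c - 1) * q⁻¹) =ᶠ[nhds 0] fun _ => 0 := by
        filter_upwards [Iio_mem_nhds (half_pos hc)] with q hq
        rw [Real.smoothTransition.zero_of_nonpos, zero_mul]
        have hq' : q < c / 2 := hq
        have : 2 * q / c ≤ 1 := (div_le_one hc).2 (by linarith)
        linarith
      exact contDiffAt_const.congr_of_eventuallyEq this
    · refine ContDiffAt.mul ?_ (contDiffAt_inv ℝ hq)
      exact Real.smoothTransition.contDiff.contDiffAt.comp q (by fun_prop)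
  · have : 2 ≤ 2 * q / c := (le_div_iff₀ hc).2 (by linarith)
    have hq0 : q ≠ 0 := (hc.trans_le hq).ne'
    simp only
    rw [Real.smoothTransition.one_of_one_le (by linarith), one_mul, mul_inv_cancel₀ hq0]

end UniformlySmooth

section Oscillatory

open scoped ContDiff

variable {E Θ : Type*} [NormedAddCommGroup E] [NormedSpace ℝ E] [FiniteDimensional ℝ E]
  [MeasurableSpace E] [BorelSpace E] (μ : Measure E) [μ.IsAddHaarMeasure]

/-- Non-stationary phase, uniformly over a family: if the derivative of the phase `Φ θ` in a
direction `w θ` is `l θ` times a uniformly smooth function bounded below on the support of the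
amplitude, then the oscillatory integral is `O(|l θ| ^ (-N))` for every `N`. -/
theorem exists_bound_oscillatory_integral {Φ Q : Θ → E → ℝ} {w : Θ → E} {l : Θ → ℝ} {c R : ℝ}
    (hw : ∀ θ, ‖w θ‖ ≤ 1) (hΦ : ∀ θ, ContDiff ℝ ∞ (Φ θ)) (hQ : UniformlySmooth Q)
    (hΦQ : ∀ θ x, fderiv ℝ (Φ θ) x (w θ) = l θ * Q θ x) (hc : 0 < c) (N : ℕ) :
    ∀ b : Θ → E → ℝ, UniformlySmooth b → (∀ θ x, b θ x ≠ 0 → x ∈ Metric.closedBall (0 : E) R) →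
      (∀ θ x, b θ x ≠ 0 → c ≤ Q θ x) →
      ∃ C, ∀ θ, |l θ| ^ N * ‖∫ x, b θ x • Complex.exp (Φ θ x * Complex.I) ∂μ‖ ≤ C := by
  obtain ⟨J, hJ, hJinv⟩ := exists_contDiff_mul_eq_one hc
  induction N with
  | zero =>
    intro b hb hbR _
    obtain ⟨B, hB⟩ := hb.bounded
    refine ⟨B * μ.real (Metric.closedBall (0 : E) R), fun θ => ?_⟩
    rw [pow_zero, one_mul, ← setIntegral_eq_integral_of_forall_compl_eq_zero
      (s := Metric.closedBall (0 : E) R)]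
    · refine norm_setIntegral_le_of_norm_le_const measure_closedBall_lt_top fun x _ => ?_
      rw [norm_smul, Complex.norm_exp_ofReal_mul_I, mul_one]
      exact hB θ x
    · intro x hx
      have : b θ x = 0 := by
        by_contra h
        exact hx (hbR θ x h)
      simp [this]
  | succ N ih =>
    intro b hb hbR hbQ
    have hJb : UniformlySmooth fun θ x => J (Q θ x) * b θ x := (hQ.comp hJ).mul hb
    have hts : ∀ θ x, fderiv ℝ (fun x => J (Q θ x) * b θ x) x (w θ) ≠ 0 →
        x ∈ closure (Function.support (b θ)) := by
      intro θ x hx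
      have h1 : x ∈ tsupport (fun x => J (Q θ x) * b θ x) := by
        refine support_fderiv_subset ℝ (f := fun x => J (Q θ x) * b θ x) ?_
        intro h
        rw [h] at hx
        exact hx rfl
      exact closure_mono (Function.support_mul_subset_right _ _) h1
    obtain ⟨C, hC⟩ := ih _ (hJb.fderiv_apply hw)
      (fun θ x hx => closure_minimal (fun y hy => hbR θ y hy) Metric.isClosed_closedBall
        (hts θ x hx))
      (fun θ x hx => closure_minimal (t := {y | c ≤ Q θ y}) (fun y hy => hbQ θ y hy)
        (isClosed_le continuous_const (hQ.1 θ).continuous) (hts θ x hx))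
    refine ⟨C, fun θ => ?_⟩
    have hexp : ContDiff ℝ ∞ fun x => Complex.exp (Φ θ x * Complex.I) :=
      ((Complex.ofRealCLM.contDiff.comp (hΦ θ)).mul contDiff_const).cexp
    have hderiv : ∀ x, fderiv ℝ (fun x => Complex.exp (Φ θ x * Complex.I)) x (w θ) =
        (l θ * Q θ x : ℝ) * (Complex.I * Complex.exp (Φ θ x * Complex.I)) := by
      intro x
      have h1 : HasFDerivAt (Φ θ) (fderiv ℝ (Φ θ) x) x :=
        ((hΦ θ).differentiable (by simp) x).hasFDerivAt
      have h2 := ((Complex.ofRealCLM.hasFDerivAt.comp x h1).mul_const Complex.I).cexp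
      have h3 := h2.fderiv
      simp only [Function.comp_def, Complex.ofRealCLM_apply] at h3
      rw [h3, ← hΦQ]
      simp
      ring
    have hcs : HasCompactSupport fun x => J (Q θ x) * b θ x := by
      refine HasCompactSupport.of_support_subset_isCompact
        (isCompact_closedBall (0 : E) R) fun x hx => hbR θ x ?_
      exact right_ne_zero_of_mul hx
    have hdc : Continuous fun x => fderiv ℝ (fun x => J (Q θ x) * b θ x) x (w θ) :=
      ((hJb.fderiv_apply hw).1 θ).continuous
    have hec : Continuous fun x => fderiv ℝ (fun x => Complex.exp (Φ θ x * Complex.I)) x (w θ) :=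
      (hexp.continuous_fderiv (by simp)).clm_apply continuous_const
    have hibp := integral_smul_fderiv_eq_neg_fderiv_smul_of_integrable (μ := μ)
      (f := fun x => J (Q θ x) * b θ x) (g := fun x => Complex.exp (Φ θ x * Complex.I)) (v := w θ)
      ((hdc.smul hexp.continuous).integrable_of_hasCompactSupport
        ((hcs.fderiv_apply ℝ (w θ)).smul_right))
      (((hJb.1 θ).continuous.smul hec).integrable_of_hasCompactSupport hcs.smul_right)
      (((hJb.1 θ).continuous.smul hexp.continuous).integrable_of_hasCompactSupport hcs.smul_right)
      (fun x _ => (hJb.1 θ).differentiable (by simp) x)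
      (fun x _ => hexp.differentiable (by simp) x)
    have hkey : ∀ x, (J (Q θ x) * b θ x) •
        fderiv ℝ (fun x => Complex.exp (Φ θ x * Complex.I)) x (w θ) =
        (l θ * Complex.I) * (b θ x • Complex.exp (Φ θ x * Complex.I)) := by
      intro x
      rw [hderiv]
      by_cases hx : b θ x = 0
      · simp [hx]
      · have h1 : (Q θ x : ℂ) * J (Q θ x) = 1 := by exact_mod_cast hJinv _ (hbQ θ x hx)
        simp only [Complex.real_smul, Complex.ofReal_mul]
        linear_combination (l θ * Complex.I * b θ x * Complex.exp (Φ θ x * Complex.I)) * h1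
    simp_rw [hkey] at hibp
    rw [integral_const_mul] at hibp
    have hn := congrArg norm hibp
    rw [norm_neg, norm_mul, norm_mul, Complex.norm_I, mul_one, Complex.norm_real,
      Real.norm_eq_abs] at hn
    rw [pow_succ, mul_assoc, hn]
    exact hC θ

end Oscillatory

section Decay

open scoped ContDiff

variable {E : Type*} [NormedAddCommGroup E] [MeasurableSpace E] [BorelSpace E]

theorem sq_norm_integral_le_integral_norm_autocorrelation [NormedSpace ℝ E]
    [FiniteDimensional ℝ E] (μ : Measure E) [μ.IsAddHaarMeasure]
    {g : E → ℂ} (hg : Continuous g) (hgc : HasCompactSupport g) :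
    ‖∫ x, g x ∂μ‖ ^ 2 ≤ ∫ h, ‖∫ x, g (x + h) * starRingEnd ℂ (g x) ∂μ‖ ∂μ := by
  have hcont : Continuous fun z : E × E => g (z.1 + z.2) * starRingEnd ℂ (g z.1) := by
    fun_prop
  have hint : Integrable (fun z : E × E => g (z.1 + z.2) * starRingEnd ℂ (g z.1)) (μ.prod μ) := by
    refine hcont.integrable_of_hasCompactSupport ?_
    refine HasCompactSupport.of_support_subset_isCompact
      ((hgc.isCompact.prod hgc.isCompact).image
        (by fun_prop : Continuous fun z : E × E => (z.1, z.2 - z.1))) fun z hz => ?_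
    have h1 : z.1 + z.2 ∈ tsupport g := subset_tsupport _ (left_ne_zero_of_mul hz)
    have h2 : z.1 ∈ tsupport g := subset_tsupport _ fun h => by simp [h] at hz
    exact ⟨(z.1, z.1 + z.2), ⟨h2, h1⟩, by simp⟩
  calc ‖∫ x, g x ∂μ‖ ^ 2
      = ‖(∫ x, g x ∂μ) * starRingEnd ℂ (∫ x, g x ∂μ)‖ := by simp [sq]
    _ = ‖∫ x, ∫ h, g (x + h) * starRingEnd ℂ (g x) ∂μ ∂μ‖ := by
      congr 1
      rw [← integral_conj, ← integral_const_mul]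
      congr 1
      ext x
      rw [integral_mul_const, integral_add_left_eq_self]
    _ = ‖∫ h, ∫ x, g (x + h) * starRingEnd ℂ (g x) ∂μ ∂μ‖ := by
      rw [integral_integral_swap hint]
    _ ≤ _ := norm_integral_le_integral_norm _

/-- Stationary phase decay in `t` for the phase `ℓ + t p`, where `p` is strictly convex on the
support of the amplitude. -/
theorem exists_bound_pow_mul_sq_norm_integral [NormedSpace ℝ E]
    [FiniteDimensional ℝ E] (μ : Measure E) [μ.IsAddHaarMeasure]
    {p b : E → ℝ} (hp : ContDiff ℝ ∞ p) (hpc : HasCompactSupport p)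
    (hb : ContDiff ℝ ∞ b) (hbc : HasCompactSupport b) {c : ℝ} (hc : 0 < c)
    (hconv : ∀ x h, b x ≠ 0 → b (x + h) ≠ 0 → c * ‖h‖ ^ 2 ≤ fderiv ℝ p (x + h) h - fderiv ℝ p x h) :
    ∃ C, ∀ (ℓ : E →L[ℝ] ℝ) (t : ℝ), t ≠ 0 →
      |t| ^ Module.finrank ℝ E *
        ‖∫ x, b x • Complex.exp ((ℓ x + t * p x : ℝ) * Complex.I) ∂μ‖ ^ 2 ≤ C := by
  obtain ⟨R, hR⟩ := hbc.isCompact.isBounded.subset_closedBall (0 : E)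
  set d := Module.finrank ℝ E with hd
  let Φ : (E →L[ℝ] ℝ) × ℝ × E → E → ℝ := fun θ x =>
    (θ.1 (x + θ.2.2) + θ.2.1 * p (x + θ.2.2)) - (θ.1 x + θ.2.1 * p x)
  let B : (E →L[ℝ] ℝ) × ℝ × E → E → ℝ := fun θ x => b (x + θ.2.2) * b x
  let w : (E →L[ℝ] ℝ) × ℝ × E → E := fun θ => ‖θ.2.2‖⁻¹ • θ.2.2
  have hw : ∀ θ, ‖w θ‖ ≤ 1 := fun θ => by
    simp only [w, norm_smul, norm_inv, norm_norm]
    exact inv_mul_le_one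
  have hB : UniformlySmooth B :=
    ((uniformlySmooth_of_hasCompactSupport hb hbc).comp_add _).mul
      (uniformlySmooth_of_hasCompactSupport hb hbc)
  have hBR : ∀ θ x, B θ x ≠ 0 → x ∈ Metric.closedBall (0 : E) R := fun θ x hx =>
    hR (subset_tsupport _ (right_ne_zero_of_mul hx))
  have hΦ : ∀ θ, ContDiff ℝ ∞ (Φ θ) := fun θ => by
    have h1 : ContDiff ℝ ∞ fun x => θ.1 x + θ.2.1 * p x :=
      θ.1.contDiff.add (contDiff_const.mul hp)
    exact (h1.comp (by fun_prop : ContDiff ℝ ∞ fun x => x + θ.2.2)).sub h1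
  let Q : (E →L[ℝ] ℝ) × ℝ × E → E → ℝ := fun θ x =>
    ‖θ.2.2‖⁻¹ * (fderiv ℝ p (x + θ.2.2) (w θ) - fderiv ℝ p x (w θ))
  have hQ : UniformlySmooth Q :=
    ((uniformlySmooth_of_hasCompactSupport hp hpc).fderiv_apply hw).difference_quotient _
  have hΦQ : ∀ θ x, fderiv ℝ (Φ θ) x (w θ) = (θ.2.1 * ‖θ.2.2‖) * Q θ x := by
    intro θ x
    have h1 : ∀ y, HasFDerivAt (fun x => θ.1 x + θ.2.1 * p x) (θ.1 + θ.2.1 • fderiv ℝ p y) y :=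
      fun y => θ.1.hasFDerivAt.add ((hp.differentiable (by simp) y).hasFDerivAt.const_mul _)
    have h2 := (((h1 (x + θ.2.2)).comp x ((hasFDerivAt_id x).add_const θ.2.2)).sub (h1 x)).fderiv
    have h3 : fderiv ℝ (Φ θ) x = _ := h2
    rw [h3]
    by_cases h0 : ‖θ.2.2‖ = 0
    · have : w θ = 0 := by simp [w, h0]
      rw [this]
      simp [h0]
    · simp only [Q]
      field_simp
      simp
      ring
  obtain ⟨C₀, hC₀⟩ := exists_bound_oscillatory_integral μ (Φ := Φ) (Q := fun _ _ => 1)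
    (w := fun _ => 0) (l := fun _ => 0) (by simp) hΦ UniformlySmooth.const (by simp)
    one_pos 0 B hB hBR (by simp)
  obtain ⟨C₁, hC₁⟩ := exists_bound_oscillatory_integral μ
    (Θ := {θ : (E →L[ℝ] ℝ) × ℝ × E // θ.2.2 ≠ 0})
    (fun θ => hw θ) (fun θ => hΦ θ) (hQ.reindex _) (fun θ x => hΦQ θ x) hc (d + 1)
    (fun θ => B θ) (hB.reindex _) (fun θ => hBR θ) (by
      rintro ⟨θ, hθ⟩ x hx
      have h0 : 0 < ‖θ.2.2‖ := norm_pos_iff.2 hθ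
      have := hconv x θ.2.2 (right_ne_zero_of_mul hx) (left_ne_zero_of_mul hx)
      simp only [Q, w, map_smul, smul_eq_mul]
      rw [← mul_sub, ← mul_assoc, ← sq, inv_pow, ← div_eq_inv_mul]
      exact (le_div_iff₀ (by positivity)).2 this)
  have hC₀0 : 0 ≤ C₀ := le_trans (by positivity) (hC₀ (0, 0, 0))
  have hI : ∀ (ℓ : E →L[ℝ] ℝ) (t : ℝ) (h : E),
      ‖∫ x, B (ℓ, t, h) x • Complex.exp (Φ (ℓ, t, h) x * Complex.I) ∂μ‖ ≤
        2 ^ d * (C₀ + |C₁|) * (1 + ‖t • h‖) ^ (-((d : ℝ) + 1)) := by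
    intro ℓ t h
    have h0 := hC₀ (ℓ, t, h)
    rw [pow_zero, one_mul] at h0
    have h1 : ‖t • h‖ ^ (d + 1) *
        ‖∫ x, B (ℓ, t, h) x • Complex.exp (Φ (ℓ, t, h) x * Complex.I) ∂μ‖ ≤ |C₁| := by
      by_cases hh : h = 0
      · simp [hh]
      · have := hC₁ ⟨(ℓ, t, h), hh⟩
        simp only [abs_mul, abs_norm] at this
        rw [norm_smul, Real.norm_eq_abs]
        exact this.trans (le_abs_self _)
    have e : (1 + ‖t • h‖) ^ (-((d : ℝ) + 1)) = ((1 + ‖t • h‖) ^ (d + 1))⁻¹ := by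
      rw [Real.rpow_neg (by positivity), ← Nat.cast_succ, Real.rpow_natCast]
    rw [e, ← div_eq_mul_inv, le_div_iff₀ (by positivity)]
    have h2 := add_pow_le zero_le_one (norm_nonneg (t • h)) (d + 1)
    rw [one_pow, Nat.add_sub_cancel] at h2
    calc _ ≤ ‖∫ x, B (ℓ, t, h) x • Complex.exp (Φ (ℓ, t, h) x * Complex.I) ∂μ‖ *
          (2 ^ d * (1 + ‖t • h‖ ^ (d + 1))) := by gcongr
      _ = 2 ^ d * (‖∫ x, B (ℓ, t, h) x • Complex.exp (Φ (ℓ, t, h) x * Complex.I) ∂μ‖ +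
          ‖t • h‖ ^ (d + 1) *
            ‖∫ x, B (ℓ, t, h) x • Complex.exp (Φ (ℓ, t, h) x * Complex.I) ∂μ‖) := by ring
      _ ≤ _ := by gcongr
  refine ⟨2 ^ d * (C₀ + |C₁|) * ∫ h, (1 + ‖h‖) ^ (-((d : ℝ) + 1)) ∂μ, fun ℓ t ht => ?_⟩
  have hjap : Integrable (fun h : E => (1 + ‖h‖) ^ (-((d : ℝ) + 1))) μ :=
    integrable_one_add_norm (by rw [hd]; linarith)
  have hauto := sq_norm_integral_le_integral_norm_autocorrelation μ
    (g := fun x => b x • Complex.exp ((ℓ x + t * p x : ℝ) * Complex.I))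
    (hb.continuous.smul (by have := hp.continuous; fun_prop)) hbc.smul_right
  have hrw : ∀ h x, b (x + h) • Complex.exp ((ℓ (x + h) + t * p (x + h) : ℝ) * Complex.I) *
      starRingEnd ℂ (b x • Complex.exp ((ℓ x + t * p x : ℝ) * Complex.I)) =
      B (ℓ, t, h) x • Complex.exp (Φ (ℓ, t, h) x * Complex.I) := by
    intro h x
    simp only [Complex.real_smul, map_mul, Complex.conj_ofReal, ← Complex.exp_conj,
      Complex.conj_I, B, Φ]
    rw [mul_mul_mul_comm, ← Complex.exp_add]
    push_cast
    ring_nf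
  simp_rw [hrw] at hauto
  have hmono : ∫ h, ‖∫ x, B (ℓ, t, h) x • Complex.exp (Φ (ℓ, t, h) x * Complex.I) ∂μ‖ ∂μ ≤
      ∫ h, 2 ^ d * (C₀ + |C₁|) * (1 + ‖t • h‖) ^ (-((d : ℝ) + 1)) ∂μ :=
    integral_mono_of_nonneg (Filter.Eventually.of_forall fun _ => norm_nonneg _)
      ((hjap.comp_smul ht).const_mul _) (Filter.Eventually.of_forall fun h => hI ℓ t h)
  rw [integral_const_mul, Measure.integral_comp_smul μ
    (fun h : E => (1 + ‖h‖) ^ (-((d : ℝ) + 1))), smul_eq_mul, abs_inv, abs_pow, ← hd] at hmono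
  calc _ ≤ |t| ^ d * (2 ^ d * (C₀ + |C₁|) *
        ((|t| ^ d)⁻¹ * ∫ h, (1 + ‖h‖) ^ (-((d : ℝ) + 1)) ∂μ)) := by
        gcongr
        exact hauto.trans hmono
    _ = _ := by
      have : |t| ^ d ≠ 0 := pow_ne_zero _ (abs_ne_zero.2 ht)
      field_simp

variable [InnerProductSpace ℝ E] [FiniteDimensional ℝ E] (μ : Measure E) [μ.IsAddHaarMeasure]

theorem exists_bound_norm_integral_of_le_norm
    {p b : E → ℝ} (hp : ContDiff ℝ ∞ p) (hpc : HasCompactSupport p)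
    (hb : ContDiff ℝ ∞ b) (hbc : HasCompactSupport b) (N : ℕ) :
    ∃ A C : ℝ, 1 ≤ A ∧ ∀ (x : E) (t : ℝ), x ≠ 0 → A * |t| ≤ ‖x‖ →
      ‖x‖ ^ N * ‖∫ ξ, b ξ • Complex.exp ((inner ℝ x ξ + t * p ξ : ℝ) * Complex.I) ∂μ‖ ≤ C := by
  obtain ⟨R, hR⟩ := hbc.isCompact.isBounded.subset_closedBall (0 : E)
  have hDp := (uniformlySmooth_of_hasCompactSupport (Θ := {w : E // ‖w‖ ≤ 1}) hp hpc).fderiv_apply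
    (fun w => w.2)
  obtain ⟨M, hM⟩ := hDp.bounded
  have hM0 : 0 ≤ M := (abs_nonneg _).trans (hM ⟨0, by simp⟩ 0)
  let Θ := {θ : E × ℝ // θ.1 ≠ 0 ∧ (2 * M + 1) * |θ.2| ≤ ‖θ.1‖}
  let w : Θ → {w : E // ‖w‖ ≤ 1} := fun θ => ⟨‖θ.1.1‖⁻¹ • θ.1.1, by
    rw [norm_smul, norm_inv, norm_norm]
    exact inv_mul_le_one⟩
  have hpos : ∀ θ : Θ, 0 < ‖θ.1.1‖ := fun θ => norm_pos_iff.2 θ.2.1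
  have hratio : ∀ θ : Θ, (2 * M + 1) * |θ.1.2 / ‖θ.1.1‖| ≤ 1 := fun θ => by
    rw [abs_div, abs_norm, ← mul_div_assoc]
    exact (div_le_one (hpos θ)).2 θ.2.2
  obtain ⟨C, hC⟩ := exists_bound_oscillatory_integral μ (Θ := Θ)
    (Φ := fun θ ξ => inner ℝ θ.1.1 ξ + θ.1.2 * p ξ)
    (Q := fun θ ξ => 1 + θ.1.2 / ‖θ.1.1‖ * fderiv ℝ p ξ (w θ)) (w := fun θ => w θ)
    (l := fun θ => ‖θ.1.1‖) (c := 1 / 2) (R := R) (fun θ => (w θ).2)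
    (fun θ => (innerSL ℝ θ.1.1).contDiff.add (contDiff_const.mul hp))
    (UniformlySmooth.const.add ((hDp.reindex w).const_mul (M := 1) fun θ => by
      nlinarith [hratio θ, abs_nonneg (θ.1.2 / ‖θ.1.1‖)]))
    (fun θ ξ => by
      have h1 : HasFDerivAt (fun ξ => inner ℝ θ.1.1 ξ + θ.1.2 * p ξ)
          (innerSL ℝ θ.1.1 + θ.1.2 • fderiv ℝ p ξ) ξ :=
        (innerSL ℝ θ.1.1).hasFDerivAt.add
          ((hp.differentiable (by simp) ξ).hasFDerivAt.const_mul _)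
      have h2 := (hpos θ).ne'
      rw [h1.fderiv]
      simp only [w, add_apply, innerSL_apply_apply, inner_smul_right,
        real_inner_self_eq_norm_sq, smul_apply, smul_eq_mul]
      field_simp) (by norm_num) N (fun _ => b)
    (uniformlySmooth_of_hasCompactSupport hb hbc)
    (fun _ ξ hξ => hR (subset_tsupport _ hξ))
    (fun θ ξ _ => by
      have h1 := hratio θ
      have h2 : |θ.1.2 / ‖θ.1.1‖ * fderiv ℝ p ξ (w θ)| ≤ 1 / 2 := by
        rw [abs_mul]
        calc _ ≤ |θ.1.2 / ‖θ.1.1‖| * M := by gcongr; exact hM (w θ) ξ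
          _ ≤ 1 / 2 := by nlinarith [abs_nonneg (θ.1.2 / ‖θ.1.1‖)]
      linarith [(abs_le.1 h2).1])
  refine ⟨2 * M + 1, C, by linarith, fun x t hx ht => ?_⟩
  have := hC ⟨(x, t), hx, ht⟩
  simpa only [abs_norm] using this

theorem exists_bound_norm_integral_one_add_rpow
    {p b : E → ℝ} (hp : ContDiff ℝ ∞ p) (hpc : HasCompactSupport p)
    (hb : ContDiff ℝ ∞ b) (hbc : HasCompactSupport b) {c : ℝ} (hc : 0 < c)
    (hconv : ∀ x h, b x ≠ 0 → b (x + h) ≠ 0 → c * ‖h‖ ^ 2 ≤ fderiv ℝ p (x + h) h - fderiv ℝ p x h) :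
    ∃ C, ∀ (x : E) (t : ℝ),
      ‖∫ ξ, b ξ • Complex.exp ((inner ℝ x ξ + t * p ξ : ℝ) * Complex.I) ∂μ‖ ≤
        C * (1 + √(‖x‖ ^ 2 + t ^ 2)) ^ (-(Module.finrank ℝ E : ℝ) / 2) := by
  set d := Module.finrank ℝ E with hd
  obtain ⟨A, C₁, hA, hC₁⟩ := exists_bound_norm_integral_of_le_norm μ hp hpc hb hbc d
  obtain ⟨C₂, hC₂⟩ := exists_bound_pow_mul_sq_norm_integral μ hp hpc hb hbc hc hconv
  let F : E → ℝ → ℝ := fun x t =>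
    ‖∫ ξ, b ξ • Complex.exp ((inner ℝ x ξ + t * p ξ : ℝ) * Complex.I) ∂μ‖
  have hF0 : ∀ x t, 0 ≤ F x t := fun x t => norm_nonneg _
  let C₀ := ∫ ξ, |b ξ| ∂μ
  have hC₀ : ∀ x t, F x t ≤ C₀ := fun x t =>
    (norm_integral_le_integral_norm _).trans_eq (by
      simp only [norm_smul, Complex.norm_exp_ofReal_mul_I, mul_one, Real.norm_eq_abs, C₀])
  have hC₀0 : 0 ≤ C₀ := (hF0 0 0).trans (hC₀ 0 0)
  have hsq : ∀ x t, F x t ^ 2 * (1 + √(‖x‖ ^ 2 + t ^ 2)) ^ d ≤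
      C₀ ^ 2 * 2 ^ d + C₀ * 4 ^ d * |C₁| + (2 * (A + 1)) ^ d * |C₂| := by
    intro x t
    have hr : √(‖x‖ ^ 2 + t ^ 2) ≤ ‖x‖ + |t| := by
      refine Real.sqrt_le_iff.2 ⟨by positivity, ?_⟩
      nlinarith [sq_abs t, norm_nonneg x, abs_nonneg t, mul_nonneg (norm_nonneg x) (abs_nonneg t)]
    set r := √(‖x‖ ^ 2 + t ^ 2)
    have hr0 : 0 ≤ r := Real.sqrt_nonneg _
    have hT0 : 0 ≤ C₀ ^ 2 * 2 ^ d := by positivity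
    have hT1 : 0 ≤ C₀ * 4 ^ d * |C₁| := by positivity
    have hT2 : 0 ≤ (2 * (A + 1)) ^ d * |C₂| := by positivity
    have hFx := hF0 x t
    rcases le_or_gt r 1 with h1 | h1
    · have : F x t ^ 2 * (1 + r) ^ d ≤ C₀ ^ 2 * 2 ^ d := by
        gcongr
        · exact hC₀ x t
        · linarith
      linarith
    rcases le_or_gt (A * |t|) ‖x‖ with h2 | h2
    · have hxt : |t| ≤ ‖x‖ := (le_mul_of_one_le_left (abs_nonneg t) hA).trans h2
      have hx : x ≠ 0 := by
        rintro rfl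
        rw [norm_zero] at hr hxt
        linarith
      have h3 : ‖x‖ ^ d * F x t ≤ |C₁| := (hC₁ x t hx h2).trans (le_abs_self _)
      have : F x t ^ 2 * (1 + r) ^ d ≤ C₀ * 4 ^ d * |C₁| :=
        calc F x t ^ 2 * (1 + r) ^ d ≤ (C₀ * F x t) * (4 * ‖x‖) ^ d := by
              rw [sq]
              gcongr
              · exact hC₀ x t
              · linarith
          _ = C₀ * 4 ^ d * (‖x‖ ^ d * F x t) := by rw [mul_pow]; ring
          _ ≤ _ := by gcongr
      linarith
    · have ht : t ≠ 0 := by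
        rintro rfl
        rw [abs_zero, mul_zero] at h2
        exact absurd h2 (not_lt.2 (norm_nonneg x))
      have h3 : |t| ^ d * F x t ^ 2 ≤ |C₂| := (hC₂ (innerSL ℝ x) t ht).trans (le_abs_self _)
      have : F x t ^ 2 * (1 + r) ^ d ≤ (2 * (A + 1)) ^ d * |C₂| :=
        calc F x t ^ 2 * (1 + r) ^ d ≤ F x t ^ 2 * (2 * (A + 1) * |t|) ^ d := by
              gcongr
              linarith
          _ = (2 * (A + 1)) ^ d * (|t| ^ d * F x t ^ 2) := by rw [mul_pow _ |t|]; ring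
          _ ≤ _ := by gcongr
      linarith
  refine ⟨√(C₀ ^ 2 * 2 ^ d + C₀ * 4 ^ d * |C₁| + (2 * (A + 1)) ^ d * |C₂|), fun x t => ?_⟩
  have hr1 : 0 < 1 + √(‖x‖ ^ 2 + t ^ 2) := by positivity
  refine le_of_sq_le_sq ?_ (by positivity)
  rw [mul_pow, Real.sq_sqrt (by positivity), ← Real.rpow_natCast (_ ^ _) 2, ← Real.rpow_mul hr1.le,
    Nat.cast_ofNat, div_mul_cancel₀ _ (two_ne_zero' ℝ), Real.rpow_neg hr1.le, Real.rpow_natCast,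
    ← div_eq_mul_inv, le_div_iff₀ (by positivity)]
  exact hsq x t

end Decay

section NormPow

open scoped ContDiff

variable {E : Type*} [NormedAddCommGroup E] [InnerProductSpace ℝ E]

/-- The gradient of `‖x‖ ^ a` is strongly monotone on an annulus. -/
theorem exists_pos_mul_sq_norm_sub_le_inner_norm_rpow {a : ℝ} (ha : 1 < a) :
    ∃ c : ℝ, 0 < c ∧ ∀ x y : E, ‖x‖ ∈ Ioo (1 / 2 : ℝ) 2 → ‖y‖ ∈ Ioo (1 / 2 : ℝ) 2 →
      c * ‖y - x‖ ^ 2 ≤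
        a * ‖y‖ ^ (a - 2) * inner ℝ y (y - x) - a * ‖x‖ ^ (a - 2) * inner ℝ x (y - x) := by
  have hcont : ContinuousOn (fun r : ℝ => r ^ (a - 2)) (Icc (1 / 2) 2) :=
    continuousOn_id.rpow_const fun r hr => Or.inl (by
      have : (1 / 2 : ℝ) ≤ r := hr.1
      simp only [id]
      linarith)
  obtain ⟨r₀, hr₀, hmin⟩ := isCompact_Icc.exists_isMinOn ⟨1, by norm_num⟩ hcont
  have hr₀' : 0 < r₀ := lt_of_lt_of_le (by norm_num) hr₀.1
  set m := r₀ ^ (a - 2)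
  have hm : 0 < m := Real.rpow_pos_of_pos hr₀' _
  have hle : ∀ r ∈ Ioo (1 / 2 : ℝ) 2, m ≤ r ^ (a - 2) := fun r hr =>
    hmin (Ioo_subset_Icc_self hr)
  set c := min (a * m) (a * (a - 1) * m)
  have hc1 : c ≤ a * m := min_le_left _ _
  have hc2 : c ≤ a * (a - 1) * m := min_le_right _ _
  have ha1 : 0 < a - 1 := by linarith
  have hderiv : ∀ r : ℝ, 0 < r →
      HasDerivAt (fun r : ℝ => a * r ^ (a - 1)) (a * (a - 1) * r ^ (a - 2)) r := by
    intro r hr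
    have := (Real.hasDerivAt_rpow_const (p := a - 1) (Or.inl hr.ne')).const_mul a
    convert! this using 1
    rw [show a - 1 - 1 = a - 2 by ring]
    ring
  have hmono : ∀ q ∈ Ioo (1 / 2 : ℝ) 2, ∀ r ∈ Ioo (1 / 2 : ℝ) 2, q ≤ r →
      c * (r - q) ≤ a * r ^ (a - 1) - a * q ^ (a - 1) := by
    have hpos : ∀ r ∈ Ioo (1 / 2 : ℝ) 2, 0 < r := fun r hr => lt_trans (by norm_num) hr.1
    refine Convex.mul_sub_le_image_sub_of_le_deriv (convex_Ioo _ _)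
      (fun r hr => (hderiv r (hpos r hr)).continuousAt.continuousWithinAt)
      (fun r hr => (hderiv r (hpos r (interior_subset hr))).differentiableAt.differentiableWithinAt)
      fun r hr => ?_
    rw [(hderiv r (hpos r (interior_subset hr))).deriv]
    exact hc2.trans (mul_le_mul_of_nonneg_left (hle r (interior_subset hr)) (by positivity))
  refine ⟨c, lt_min (by positivity) (by positivity), fun x y hx hy => ?_⟩
  have hpow : ∀ r ∈ Ioo (1 / 2 : ℝ) 2, a * r ^ (a - 1) = a * r ^ (a - 2) * r := fun r hr => by
    have hr0 : r ≠ 0 := (lt_trans (by norm_num) hr.1).ne'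
    rw [mul_assoc, ← Real.rpow_add_one hr0]
    ring_nf
  have hradial : c * (‖y‖ - ‖x‖) ^ 2 ≤
      (a * ‖y‖ ^ (a - 2) * ‖y‖ - a * ‖x‖ ^ (a - 2) * ‖x‖) * (‖y‖ - ‖x‖) := by
    rw [← hpow _ hx, ← hpow _ hy]
    rcases le_total ‖x‖ ‖y‖ with h | h
    · nlinarith [hmono _ hx _ hy h]
    · nlinarith [hmono _ hy _ hx h]
  have hk : ∀ r ∈ Ioo (1 / 2 : ℝ) 2, c ≤ a * r ^ (a - 2) := fun r hr =>
    hc1.trans (mul_le_mul_of_nonneg_left (hle r hr) (by linarith))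
  have hcs : 0 ≤ ‖y‖ * ‖x‖ - inner ℝ y x := sub_nonneg.2 (real_inner_le_norm y x)
  rw [norm_sub_sq_real, inner_sub_right, inner_sub_right, real_inner_self_eq_norm_sq,
    real_inner_self_eq_norm_sq, real_inner_comm y x]
  nlinarith [mul_nonneg (sub_nonneg.2 (hk _ hx)) hcs, mul_nonneg (sub_nonneg.2 (hk _ hy)) hcs]

/-- A smooth compactly supported function equal to `‖x‖ ^ a` on an annulus. -/
theorem exists_contDiff_hasCompactSupport_eq_norm_rpow [FiniteDimensional ℝ E] {a : ℝ}
    (ha : 1 < a) :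
    ∃ p : E → ℝ, ContDiff ℝ ∞ p ∧ HasCompactSupport p ∧
      (∀ x, ‖x‖ ∈ Ioo (1 / 2 : ℝ) 2 → p x = ‖x‖ ^ a) ∧
      ∀ x v, ‖x‖ ∈ Ioo (1 / 2 : ℝ) 2 → fderiv ℝ p x v = a * ‖x‖ ^ (a - 2) * inner ℝ x v := by
  let p : E → ℝ := fun x => Real.smoothTransition (8 * ‖x‖ ^ 2 - 1) *
    Real.smoothTransition (5 - ‖x‖ ^ 2) * ‖x‖ ^ a
  have hp : ∀ x, ‖x‖ ∈ Ioo (1 / 2 : ℝ) 2 → p x = ‖x‖ ^ a := fun x hx => by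
    simp only [p]
    rw [Real.smoothTransition.one_of_one_le (by nlinarith [hx.1]),
      Real.smoothTransition.one_of_one_le (by nlinarith [hx.1, hx.2]), one_mul, one_mul]
  refine ⟨p, contDiff_iff_contDiffAt.2 fun x => ?_, ?_, hp, fun x v hx => ?_⟩
  · by_cases hx : x = 0
    · subst hx
      have : p =ᶠ[nhds 0] fun _ => 0 := by
        filter_upwards [Metric.ball_mem_nhds (0 : E) (by norm_num : (0 : ℝ) < 1 / 3)] with y hy
        have hy' : ‖y‖ < 1 / 3 := by simpa using hy
        simp only [p]
        rw [Real.smoothTransition.zero_of_nonpos (by nlinarith [norm_nonneg y]), zero_mul, zero_mul]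
      exact contDiffAt_const.congr_of_eventuallyEq this
    · have h1 : ContDiffAt ℝ ∞ (fun x : E => ‖x‖ ^ a) x :=
        (Real.contDiffAt_rpow_const_of_ne (norm_ne_zero_iff.2 hx)).comp x (contDiffAt_norm ℝ hx)
      have h2 : ContDiff ℝ ∞ fun x : E => ‖x‖ ^ 2 := contDiff_norm_sq ℝ
      have h3 : ContDiff ℝ ∞ fun x : E => Real.smoothTransition (8 * ‖x‖ ^ 2 - 1) *
          Real.smoothTransition (5 - ‖x‖ ^ 2) :=
        (Real.smoothTransition.contDiff.comp ((contDiff_const.mul h2).sub contDiff_const)).mul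
          (Real.smoothTransition.contDiff.comp (contDiff_const.sub h2))
      exact h3.contDiffAt.mul h1
  · refine HasCompactSupport.intro (isCompact_closedBall (0 : E) 3) fun x hx => ?_
    have hx' : 3 < ‖x‖ := by simpa using hx
    simp only [p]
    rw [Real.smoothTransition.zero_of_nonpos (x := 5 - ‖x‖ ^ 2) (by nlinarith), mul_zero, zero_mul]
  · have hev : p =ᶠ[nhds x] fun x => ‖x‖ ^ a := by
      filter_upwards [(isOpen_Ioo.preimage continuous_norm).mem_nhds hx] with y hy using hp y hy
    rw [hev.fderiv_eq, (hasFDerivAt_norm_rpow x ha).fderiv]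
    simp

/-- A smooth function of the norm vanishing on a neighbourhood of the origin is smooth. -/
theorem ContDiff.comp_norm_of_support_subset {f : ℝ → ℝ} (hf : ContDiff ℝ ∞ f) {ε : ℝ}
    (hε : 0 < ε) (hsupp : Function.support f ⊆ Ioi ε) : ContDiff ℝ ∞ fun x : E => f ‖x‖ := by
  refine contDiff_iff_contDiffAt.2 fun x => ?_
  by_cases hx : x = 0
  · subst hx
    have : (fun x : E => f ‖x‖) =ᶠ[nhds 0] fun _ => 0 := by
      filter_upwards [Metric.ball_mem_nhds (0 : E) hε] with y hy
      by_contra h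
      have h1 : ε < ‖y‖ := hsupp h
      have h2 : ‖y‖ < ε := by simpa using hy
      exact lt_asymm h1 h2
    exact contDiffAt_const.congr_of_eventuallyEq this
  · exact hf.contDiffAt.comp x (contDiffAt_norm ℝ hx)

end NormPow

/-- for `a > 1` and a smooth bump `φ` supported in `(1/2, 2)`,
the kernel `K(x,t) = ∫ e^{i(x·ξ + t|ξ|^a)} φ(|ξ|)² dξ` satisfies
`|K(x,t)| ≤ C (1 + |(x,t)|)^{-n/2}`. -/
theorem statement_12 (n : ℕ) (a : ℝ) (ha : 1 < a) (φ : ℝ → ℝ)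
    (hφ : ContDiff ℝ (⊤ : ℕ∞) φ) (hsupp : Function.support φ ⊆ Set.Ioo (1 / 2) 2) :
    ∃ C : ℝ, ∀ (x : Fin n → ℝ) (t : ℝ),
      ‖∫ ξ : Fin n → ℝ,
          Complex.exp (Complex.I *
            (((∑ i, x i * ξ i) + t * (Real.sqrt (∑ i, (ξ i) ^ 2)) ^ a : ℝ) : ℂ)) *
            ((φ (Real.sqrt (∑ i, (ξ i) ^ 2)) : ℂ)) ^ 2‖ ≤
        C * (1 + Real.sqrt ((∑ i, (x i) ^ 2) + t ^ 2)) ^ (-(n : ℝ) / 2) := by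
  obtain ⟨p, hp, hpc, hpeq, hpderiv⟩ :=
    exists_contDiff_hasCompactSupport_eq_norm_rpow (E := EuclideanSpace ℝ (Fin n)) ha
  obtain ⟨c, hc, hmono⟩ :=
    exists_pos_mul_sq_norm_sub_le_inner_norm_rpow (E := EuclideanSpace ℝ (Fin n)) ha
  have hne : ∀ ξ : EuclideanSpace ℝ (Fin n), φ ‖ξ‖ ^ 2 ≠ 0 → ‖ξ‖ ∈ Ioo (1 / 2 : ℝ) 2 :=
    fun ξ h => hsupp (pow_ne_zero_iff two_ne_zero |>.1 h)
  obtain ⟨C, hC⟩ := exists_bound_norm_integral_one_add_rpow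
    (volume : Measure (EuclideanSpace ℝ (Fin n))) (b := fun ξ => φ ‖ξ‖ ^ 2) hp hpc
    ((hφ.comp_norm_of_support_subset one_half_pos (hsupp.trans Ioo_subset_Ioi_self)).pow 2)
    (HasCompactSupport.of_support_subset_isCompact (isCompact_closedBall 0 2) fun ξ hξ => by
      simpa using (hne ξ hξ).2.le) hc
    (fun ξ h h1 h2 => by
      have := hmono ξ (ξ + h) (hne _ h1) (hne _ h2)
      rwa [add_sub_cancel_left, ← hpderiv _ _ (hne _ h1), ← hpderiv _ _ (hne _ h2)] at this)
  refine ⟨C, fun x t => ?_⟩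
  have hx := hC (WithLp.toLp 2 x) t
  rw [finrank_euclideanSpace_fin, EuclideanSpace.real_norm_sq_eq] at hx
  refine le_trans (le_of_eq ?_) hx
  congr 1
  rw [← (PiLp.volume_preserving_toLp (Fin n)).integral_comp
    (MeasurableEquiv.toLp 2 (Fin n → ℝ)).measurableEmbedding]
  congr 1
  ext ξ
  have hnorm : √(∑ i, ξ i ^ 2) = ‖WithLp.toLp 2 ξ‖ := by
    rw [EuclideanSpace.norm_eq]
    simp
  rw [hnorm]
  by_cases h0 : φ ‖WithLp.toLp 2 ξ‖ ^ 2 = 0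
  · have h1 : φ ‖WithLp.toLp 2 ξ‖ = 0 := pow_eq_zero_iff two_ne_zero |>.1 h0
    simp [h1]
  · have hinner : inner ℝ (WithLp.toLp 2 x) (WithLp.toLp 2 ξ) = ∑ i, x i * ξ i := by
      simp [PiLp.inner_apply, mul_comm]
    rw [hpeq _ (hne _ h0), hinner, Complex.real_smul, Complex.ofReal_pow, mul_comm, mul_comm Complex.I]
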